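/- Let A = [a_1,...,a_r] be an admissible twig, let B be the adjoint of A (the unique admissible twig with d(B) = d(A) and d(B̄) = d(A) − d(A̲)), and let n ≥ 2 and ℓ ≥ 0 be integers. Consider the star matrix S(2; T_1, T_2, T_3) with arms T_1 = [a_r,...,a_1, n] (the reversal of A with n appended), T_2 = B, and T_3 = [2,...,2] (ℓ copies of 2; if ℓ = 0 this arm is absent, i.e. the matrix is S(2; T_1, T_2)). Then this star matrix is positive definite if and only if ℓ ≤ d(A)·(n·d(A) − d(Ā)) − 2. -/

import Mathlib

open Matrix BigOperators

/-- The intersection-type matrix of a twig `A = [a_1,...,a_r]`: the `r × r` symmetric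
tridiagonal matrix with diagonal entries `a_1,...,a_r` and `-1` on the sub/super-diagonals. -/
def twigMatrix (A : List ℤ) : Matrix (Fin A.length) (Fin A.length) ℤ :=
  fun i j =>
    if i = j then A.get i
    else if (i : ℕ) + 1 = (j : ℕ) ∨ (j : ℕ) + 1 = (i : ℕ) then -1
    else 0

/-- The determinant `d(A)` of a twig; in particular `d([]) = 1`. -/
def twigDet (A : List ℤ) : ℤ := (twigMatrix A).det

/-- A twig is admissible if it is nonempty and all its entries are `≥ 2`. -/
def Admissible (A : List ℤ) : Prop := A ≠ [] ∧ ∀ a ∈ A, 2 ≤ a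

/-- The star matrix `S(c; T_1,...,T_k)`: symmetric matrix indexed by a central index
together with the disjoint union of the index sets of the twigs `T i`, with diagonal
entry `c` at the center, the principal submatrix on the indices of `T i` equal to
`M(T i)`, entries `-1` between the center and the first index of each `T i`, and
all other entries `0`. -/
def starMatrix (c : ℤ) {k : ℕ} (T : Fin k → List ℤ) :
    Matrix (Unit ⊕ (Σ i : Fin k, Fin (T i).length))
           (Unit ⊕ (Σ i : Fin k, Fin (T i).length)) ℤ :=
  fun p q =>
    match p, q with
    | Sum.inl _, Sum.inl _ => c
    | Sum.inl _, Sum.inr ⟨_, j⟩ => if (j : ℕ) = 0 then -1 else 0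
    | Sum.inr ⟨_, j⟩, Sum.inl _ => if (j : ℕ) = 0 then -1 else 0
    | Sum.inr ⟨i, j⟩, Sum.inr ⟨i', j'⟩ =>
        if h : i = i' then twigMatrix (T i) j (Fin.cast (by rw [h]) j') else 0

def FF : List ℤ → Matrix (Fin 2) (Fin 2) ℤ
  | [] => 1
  | t :: T => !![t, -1; 1, 0] * FF T

lemma FF_cons00 (t : ℤ) (T : List ℤ) : FF (t :: T) 0 0 = t * FF T 0 0 - FF T 1 0 := by
  simp [FF, Matrix.mul_apply, Fin.sum_univ_two]; ring

lemma FF_cons10 (t : ℤ) (T : List ℤ) : FF (t :: T) 1 0 = FF T 0 0 := by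
  simp [FF, Matrix.mul_apply, Fin.sum_univ_two]

lemma FF_append (S T : List ℤ) : FF (S ++ T) = FF S * FF T := by
  induction S with
  | nil => simp [FF]
  | cons t S ih => simp [FF, ih, Matrix.mul_assoc]

lemma FF_det (T : List ℤ) : (FF T).det = 1 := by
  induction T with
  | nil => simp [FF]
  | cons t S ih => rw [FF, Matrix.det_mul, ih]; simp [Matrix.det_fin_two]

lemma FF_single (t : ℤ) : FF [t] = !![t, -1; 1, 0] := by simp [FF]

lemma FF_reverse (T : List ℤ) :
    FF T.reverse = !![FF T 0 0, - FF T 1 0; - FF T 0 1, FF T 1 1] := by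
  induction T with
  | nil => ext i j; fin_cases i <;> fin_cases j <;> simp [FF]
  | cons t S ih =>
    rw [List.reverse_cons, FF_append, ih, FF_single, FF]
    ext i j; fin_cases i <;> fin_cases j <;>
      simp [Matrix.mul_apply, Fin.sum_univ_two] <;> ring

lemma FF_pos (T : List ℤ) (h : ∀ a ∈ T, 2 ≤ a) : 0 ≤ FF T 1 0 ∧ FF T 1 0 < FF T 0 0 := by
  induction T with
  | nil => simp [FF]
  | cons t S ih =>
    obtain ⟨h1, h2⟩ := ih (fun a ha => h a (by simp [ha]))
    have := h t (by simp)
    rw [FF_cons00, FF_cons10]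
    constructor <;> nlinarith

lemma FF_rep (l : ℕ) : FF (List.replicate l 2) 0 0 = l + 1 ∧ FF (List.replicate l 2) 1 0 = l := by
  induction l with
  | zero => simp [FF]
  | succ l ih =>
    rw [List.replicate_succ, FF_cons00, FF_cons10, ih.1, ih.2]; push_cast
    constructor <;> ring

lemma tM_succ (t : ℤ) (T : List ℤ) (i j : Fin T.length) :
    twigMatrix (t :: T) i.succ j.succ = twigMatrix T i j := by
  simp [twigMatrix, Fin.ext_iff]
  
lemma tM_zero_succ (t : ℤ) (T : List ℤ) (j : Fin T.length) :
    twigMatrix (t :: T) 0 j.succ = if (j : ℕ) = 0 then -1 else 0 := by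
  simp [twigMatrix, Fin.ext_iff, eq_comm]

lemma tM_succ_zero (t : ℤ) (T : List ℤ) (j : Fin T.length) :
    twigMatrix (t :: T) j.succ 0 = if (j : ℕ) = 0 then -1 else 0 := by
  simp [twigMatrix, Fin.ext_iff, eq_comm]

lemma tM_zero_zero (t : ℤ) (T : List ℤ) : twigMatrix (t :: T) 0 0 = t := by
  simp [twigMatrix]

lemma tD_nil : twigDet [] = 1 := by
  simp [twigDet]

lemma tD_single (t : ℤ) : twigDet [t] = t := by
  unfold twigDet
  exact (Matrix.det_fin_one _).trans (tM_zero_zero t [])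

lemma tD_cons_cons (t s : ℤ) (T : List ℤ) :
    twigDet (t :: s :: T) = t * twigDet (s :: T) - twigDet T := by
  have h1 : twigDet (t :: s :: T) = _ :=
    Matrix.det_succ_row_zero (n := T.length + 1) (twigMatrix (t :: s :: T))
  rw [h1, Fin.sum_univ_succ, Fin.sum_univ_succ]
  rw [Finset.sum_eq_zero (s := Finset.univ) (f := fun i : Fin T.length => _)]
  · have e1 : ((twigMatrix (t :: s :: T)).submatrix Fin.succ (Fin.succAbove (0 : Fin (T.length + 2)))).det
        = twigDet (s :: T) := by
      unfold twigDet; congr 1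
      ext i j
      rw [Matrix.submatrix_apply, Fin.succAbove_zero]
      exact tM_succ t (s :: T) i j
    have e2 : ((twigMatrix (t :: s :: T)).submatrix Fin.succ
        (Fin.succAbove (Fin.succ (0 : Fin (T.length + 1))))).det = - twigDet T := by
      rw [Matrix.det_succ_column_zero (n := T.length), Fin.sum_univ_succ, Finset.sum_eq_zero]
      · have : ((twigMatrix (t :: s :: T)).submatrix Fin.succ
          (Fin.succAbove (Fin.succ (0 : Fin (T.length + 1))))) 0 0 = -1 := by
          simpa using tM_succ_zero t (s :: T) 0
        rw [this]
        have : (((twigMatrix (t :: s :: T)).submatrix Fin.succ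
          (Fin.succAbove (Fin.succ (0 : Fin (T.length + 1))))).submatrix
            (Fin.succAbove 0) Fin.succ).det = twigDet T := by
          unfold twigDet; congr 1
          ext i j
          rw [Matrix.submatrix_apply, Matrix.submatrix_apply, Fin.succAbove_zero,
            Fin.succ_succAbove_succ, Fin.succAbove_zero]
          exact (tM_succ t (s :: T) i.succ j.succ).trans (tM_succ s T i j)
        rw [this]; simp
      · intro i _
        have : ((twigMatrix (t :: s :: T)).submatrix Fin.succ
          (Fin.succAbove (Fin.succ (0 : Fin (T.length + 1))))) i.succ 0 = 0 := by
          simpa using tM_succ_zero t (s :: T) i.succ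
        rw [this]; simp
    have e3 : twigMatrix (t :: s :: T) 0 (Fin.succ (0 : Fin (T.length + 1))) = -1 := by
      simpa using tM_zero_succ t (s :: T) 0
    have e4 := tM_zero_zero t (s :: T)
    erw [e1, e2, e3, e4]
    simp; ring
  · intro i _
    have e3 : twigMatrix (t :: s :: T) 0 (Fin.succ (Fin.succ i)) = 0 := by
      simpa using tM_zero_succ t (s :: T) i.succ
    rw [e3]; simp

lemma tD_eq : ∀ T : List ℤ, twigDet T = FF T 0 0
  | [] => by simp [tD_nil, FF]
  | [t] => by simp [tD_single, FF]
  | t :: s :: T => by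
    rw [tD_cons_cons, tD_eq (s :: T), tD_eq T, FF_cons00 t, FF_cons10]

/-- the quadratic form of an arm attached to a centre with value `u` -/
def QQ (T : List ℤ) (u : ℚ) (x : Fin T.length → ℚ) : ℚ :=
  ∑ i, ∑ j, x i * (twigMatrix T i j : ℚ) * x j
    + 2 * ∑ j : Fin T.length, (((if (j : ℕ) = 0 then -1 else 0 : ℤ) : ℚ) * u * x j)

lemma QQ_cons (t : ℤ) (T : List ℤ) (u : ℚ) (x : Fin (T.length + 1) → ℚ) :
    QQ (t :: T) u x = t * x 0 ^ 2 - 2 * u * x 0 + QQ T (x 0) (fun i => x i.succ) := by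
  obtain ⟨M, hM⟩ : ∃ M : Matrix (Fin (T.length + 1)) (Fin (T.length + 1)) ℤ,
    M = twigMatrix (t :: T) := ⟨_, rfl⟩
  have h1 : QQ (t :: T) u x = ∑ i : Fin (T.length + 1), ∑ j : Fin (T.length + 1),
      x i * (M i j : ℚ) * x j
    + 2 * ∑ j : Fin (T.length + 1), (((if (j : ℕ) = 0 then -1 else 0 : ℤ) : ℚ) * u * x j) := by
    subst hM; rfl
  have e0 : M 0 0 = t := by subst hM; exact tM_zero_zero t T
  have e1 : ∀ i j : Fin T.length, M i.succ j.succ = twigMatrix T i j := by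
    subst hM; exact tM_succ t T
  have e2 : ∀ j : Fin T.length, M 0 j.succ = if (j : ℕ) = 0 then -1 else 0 := by
    subst hM; exact tM_zero_succ t T
  have e3 : ∀ j : Fin T.length, M j.succ 0 = if (j : ℕ) = 0 then -1 else 0 := by
    subst hM; exact tM_succ_zero t T
  rw [h1]
  simp only [Fin.sum_univ_succ (n := T.length), Finset.sum_add_distrib]
  simp only [e0, e1, e2, e3, QQ]
  have e4 : ∑ j : Fin T.length, x j.succ * (((if (j : ℕ) = 0 then -1 else 0 : ℤ)) : ℚ) * x 0
     = ∑ j : Fin T.length, (((if (j : ℕ) = 0 then -1 else 0 : ℤ) : ℚ) * x 0 * x j.succ) :=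
    Finset.sum_congr rfl fun _ _ => by ring
  have e5 : ∑ j : Fin T.length, x 0 * (((if (j : ℕ) = 0 then -1 else 0 : ℤ)) : ℚ) * x j.succ
     = ∑ j : Fin T.length, (((if (j : ℕ) = 0 then -1 else 0 : ℤ) : ℚ) * x 0 * x j.succ) :=
    Finset.sum_congr rfl fun _ _ => by ring
  rw [e4, e5]
  simp
  ring

def ee (T : List ℤ) : ℚ := (FF T 1 0 : ℚ) / (FF T 0 0 : ℚ)

lemma ee_cons (t : ℤ) (T : List ℤ) (h : ∀ a ∈ t :: T, 2 ≤ a) :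
    0 < (t : ℚ) - ee T ∧ ee (t :: T) = 1 / (t - ee T) := by
  obtain ⟨h1, h2⟩ := FF_pos T (fun a ha => h a (by simp [ha]))
  have h3 := h t (by simp)
  have h4 : (0 : ℚ) < FF T 0 0 := by exact_mod_cast h1.trans_lt h2
  have h5 : (FF T 1 0 : ℚ) < FF T 0 0 := by exact_mod_cast h2
  have h6 : (2 : ℚ) ≤ t := by exact_mod_cast h3
  have h7 : ee T < 1 := by rw [ee, div_lt_one h4]; exact h5
  have h8 : 0 < (t : ℚ) - ee T := by linarith
  refine ⟨h8, ?_⟩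
  have h9 : (t : ℚ) - ee T = (t * FF T 0 0 - FF T 1 0) / FF T 0 0 := by
    rw [ee]; field_simp
  rw [h9, one_div_div, ee, FF_cons00, FF_cons10]; push_cast; rfl

lemma QQ_ge (T : List ℤ) (h : ∀ a ∈ T, 2 ≤ a) (u : ℚ) (x : Fin T.length → ℚ) :
    - u ^ 2 * ee T ≤ QQ T u x := by
  induction T generalizing u with
  | nil => simp [QQ, ee, FF]
  | cons t T ih =>
    obtain ⟨h1, h2⟩ := ee_cons t T h
    have := ih (fun a ha => h a (by simp [ha])) (x 0) (fun i => x i.succ)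
    have h3 := QQ_cons t T u x
    rw [h3, h2]
    refine le_trans ?_ (add_le_add_right this _)
    set w := (t : ℚ) - ee T with hw
    have : t * x 0 ^ 2 - 2 * u * x 0 + -x 0 ^ 2 * ee T + u ^ 2 * (1 / w)
      = w * (x 0 - u / w) ^ 2 := by
      rw [hw]; rw [hw] at h1; field_simp; ring
    have : 0 ≤ w * (x 0 - u / w) ^ 2 := by positivity
    linarith

lemma QQ_pos (T : List ℤ) (h : ∀ a ∈ T, 2 ≤ a) (x : Fin T.length → ℚ)
    (hx : QQ T 0 x ≤ 0) : x = 0 := by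
  induction T with
  | nil => funext i; exact i.elim0
  | cons t T ih =>
    obtain ⟨h1, h2⟩ := ee_cons t T h
    have hT : ∀ a ∈ T, 2 ≤ a := fun a ha => h a (by simp [ha])
    have h4 := QQ_ge T hT (x 0) (fun i => x i.succ)
    have h3 := QQ_cons t T 0 x
    rw [h3] at hx
    have h5 : ((t : ℚ) - ee T) * x 0 ^ 2 ≤ 0 := by linarith
    have h6 : x 0 = 0 := by
      by_contra hne
      have : 0 < ((t : ℚ) - ee T) * x 0 ^ 2 := by positivity
      linarith
    rw [h6] at hx
    have h7 := ih hT (fun i => x i.succ) (by simpa using hx)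
    funext i
    refine Fin.cases h6 (fun j => ?_) i
    exact congrFun h7 j

lemma QQ_attain (T : List ℤ) (h : ∀ a ∈ T, 2 ≤ a) (u : ℚ) :
    ∃ x : Fin T.length → ℚ, QQ T u x = - u ^ 2 * ee T := by
  induction T generalizing u with
  | nil => exact ⟨0, by simp [QQ, ee, FF]⟩
  | cons t T ih =>
    obtain ⟨h1, h2⟩ := ee_cons t T h
    obtain ⟨y, hy⟩ := ih (fun a ha => h a (by simp [ha])) (u / (t - ee T))
    refine ⟨(Fin.cons (u / (t - ee T)) y : Fin (T.length + 1) → ℚ), ?_⟩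
    have := QQ_cons t T u (Fin.cons (u / (t - ee T)) y : Fin (T.length + 1) → ℚ)
    rw [this, h2]
    simp only [Fin.cons_zero, Fin.cons_succ]
    rw [hy]
    field_simp
    ring

lemma star_form (c : ℤ) {k : ℕ} (T : Fin k → List ℤ)
    (x : Unit ⊕ (Σ i : Fin k, Fin (T i).length) → ℚ) :
    star x ⬝ᵥ ((starMatrix c T).map ((↑) : ℤ → ℚ)) *ᵥ x =
      c * x (Sum.inl ()) ^ 2 + ∑ i, QQ (T i) (x (Sum.inl ())) (fun j => x (Sum.inr ⟨i, j⟩)) := by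
  have key : ∀ (i : Fin k) (j : Fin (T i).length),
      ∑ p : (Σ i : Fin k, Fin (T i).length),
        ((starMatrix c T (Sum.inr ⟨i, j⟩) (Sum.inr p) : ℤ) : ℚ) * x (Sum.inr p)
      = ∑ j', (twigMatrix (T i) j j' : ℚ) * x (Sum.inr ⟨i, j'⟩) := by
    intro i j
    rw [Fintype.sum_sigma, Finset.sum_eq_single i]
    · simp [starMatrix]
    · intro b _ hb
      simp [starMatrix, hb.symm]
    · simp
  simp only [dotProduct, mulVec, Fintype.sum_sum_type, Matrix.map_apply, Finset.univ_unique,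
    Finset.sum_singleton, star_trivial, Pi.star_apply]
  rw [Fintype.sum_sigma]
  simp only [key, QQ, Fintype.sum_sigma]
  have k0 : starMatrix c T (Sum.inl ()) (Sum.inl ()) = c := rfl
  have k1 : ∀ i (j : Fin (T i).length), starMatrix c T (Sum.inl ()) (Sum.inr ⟨i, j⟩)
    = if (j : ℕ) = 0 then -1 else 0 := fun _ _ => rfl
  have k2 : ∀ i (j : Fin (T i).length), starMatrix c T (Sum.inr ⟨i, j⟩) (Sum.inl ())
    = if (j : ℕ) = 0 then -1 else 0 := fun _ _ => rfl
  simp only [PUnit.default_eq_unit, k0, k1, k2]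
  generalize x (Sum.inl ()) = u
  rw [mul_add, Finset.mul_sum, add_assoc, ← Finset.sum_add_distrib]
  congr 1
  · ring
  refine Finset.sum_congr rfl fun i _ => ?_
  rw [two_mul, Finset.mul_sum, ← Finset.sum_add_distrib, ← Finset.sum_add_distrib,
    ← Finset.sum_add_distrib]
  refine Finset.sum_congr rfl fun j _ => ?_
  rw [mul_add, Finset.mul_sum]
  have : ∀ j', x (Sum.inr ⟨i, j⟩) * ((twigMatrix (T i) j j' : ℚ) * x (Sum.inr ⟨i, j'⟩))
    = x (Sum.inr ⟨i, j⟩) * (twigMatrix (T i) j j' : ℚ) * x (Sum.inr ⟨i, j'⟩) :=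
    fun j' => by ring
  simp only [this]
  ring

lemma star_posDef_iff (c : ℤ) {k : ℕ} (T : Fin k → List ℤ) (hT : ∀ i, ∀ a ∈ T i, 2 ≤ a) :
    ((starMatrix c T).map ((↑) : ℤ → ℚ)).PosDef ↔ 0 < (c : ℚ) - ∑ i, ee (T i) := by
  rw [Matrix.posDef_iff_dotProduct_mulVec]
  constructor
  · rintro ⟨-, h⟩
    choose y hy using fun i => QQ_attain (T i) (hT i) 1
    have := @h (Sum.elim (fun _ => 1) (fun p => y p.1 p.2)) (fun h0 => by
      simpa using congrFun h0 (Sum.inl ()))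
    rw [star_form] at this
    simp only [Sum.elim_inl, Sum.elim_inr, hy] at this
    simpa [sub_eq_add_neg] using this
  · intro h
    refine ⟨?_, fun x hx => ?_⟩
    · ext p q
      rcases p with p | ⟨i, j⟩ <;> rcases q with q | ⟨i', j'⟩ <;> simp [starMatrix]
      by_cases hi : i = i'
      · subst hi
        simp [twigMatrix, eq_comm, or_comm]
        split_ifs <;> simp_all
      · simp [hi, Ne.symm hi]
    · rw [star_form]
      set u := x (Sum.inl ()) with hu
      have h1 : ∀ i, - u ^ 2 * ee (T i) ≤ QQ (T i) u (fun j => x (Sum.inr ⟨i, j⟩)) :=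
        fun i => QQ_ge (T i) (hT i) _ _
      by_cases h0 : u = 0
      · rw [h0] at h1 ⊢
        by_contra hc
        apply hx
        have h2 : ∀ i, QQ (T i) 0 (fun j => x (Sum.inr ⟨i, j⟩)) ≤ 0 := by
          intro i
          refine le_trans ?_ (not_lt.mp hc)
          have := Finset.single_le_sum (s := Finset.univ)
            (f := fun i => QQ (T i) 0 (fun j => x (Sum.inr ⟨i, j⟩)))
            (fun i _ => by simpa using h1 i) (Finset.mem_univ i)
          simpa using this
        funext p
        rcases p with p | ⟨i, j⟩
        · exact h0
        · exact congrFun (QQ_pos (T i) (hT i) _ (h2 i)) j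
      · have h2 := Finset.sum_le_sum (s := Finset.univ) (fun i _ => h1 i)
        rw [← Finset.mul_sum] at h2
        have : 0 < u ^ 2 * ((c : ℚ) - ∑ i, ee (T i)) := by positivity
        linarith

/-- let `A` be an admissible twig, `B` its adjoint (the unique admissible
twig with `d(B) = d(A)` and `d(B̄) = d(A) − d(A̲)`), and `n ≥ 2`, `ℓ ≥ 0` integers.
The star matrix `S(2; T₁, T₂, T₃)` with arms `T₁ = reverse A ++ [n]`, `T₂ = B` and
`T₃ = [ℓ * 2]` (an empty arm when `ℓ = 0`) is positive definite if and only if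
`ℓ ≤ d(A)·(n·d(A) − d(Ā)) − 2`. -/
theorem stmt8 (A B : List ℤ) (hA : Admissible A)
    (hB : Admissible B) (hd : twigDet B = twigDet A)
    (hdbar : twigDet B.tail = twigDet A - twigDet A.dropLast)
    (n : ℤ) (hn : 2 ≤ n) (ℓ : ℕ) :
    ((starMatrix 2 ![A.reverse ++ [n], B, List.replicate ℓ 2]).map ((↑) : ℤ → ℚ)).PosDef ↔
      (ℓ : ℤ) ≤ twigDet A * (n * twigDet A - twigDet A.tail) - 2 := by
  have hT1 : ∀ a ∈ A.reverse ++ [n], 2 ≤ a := by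
    intro a ha
    simp only [List.mem_append, List.mem_reverse, List.mem_singleton] at ha
    rcases ha with ha | rfl
    · exact hA.2 a ha
    · exact hn
  rw [star_posDef_iff]
  swap
  · intro i
    fin_cases i
    · exact hT1
    · exact hB.2
    · intro a ha
      exact (List.eq_of_mem_replicate ha).ge
  have htail : ∀ T : List ℤ, T ≠ [] → twigDet T.tail = FF T 1 0 := by
    intro T hT
    cases T with
    | nil => exact absurd rfl hT
    | cons t T => rw [FF_cons10, List.tail_cons, tD_eq]
  have hdrop : twigDet A.dropLast = - FF A 0 1 := by
    conv_rhs => rw [← List.dropLast_append_getLast hA.1, FF_append, FF_single]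
    simp [tD_eq, Matrix.mul_apply, Fin.sum_univ_two]
  rw [htail B hB.1, hdrop, tD_eq] at hdbar
  rw [tD_eq, tD_eq] at hd
  rw [tD_eq, htail A hA.1]
  have hdet := FF_det A
  rw [Matrix.det_fin_two] at hdet
  have e00 : FF (A.reverse ++ [n]) 0 0 = n * FF A 0 0 - FF A 1 0 := by
    rw [FF_append, FF_reverse, FF_single]
    simp [Matrix.mul_apply, Fin.sum_univ_two]; ring
  have e10 : FF (A.reverse ++ [n]) 1 0 = - n * FF A 0 1 + FF A 1 1 := by
    rw [FF_append, FF_reverse, FF_single]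
    simp [Matrix.mul_apply, Fin.sum_univ_two]; ring
  have p1 := FF_pos _ hT1
  have p2 := FF_pos A hA.2
  rw [e00] at p1
  obtain ⟨r0, r1⟩ := FF_rep ℓ
  simp only [Fin.sum_univ_three, Matrix.cons_val_zero, Matrix.cons_val_one, Matrix.cons_val]
  rw [ee, ee, ee, e00, e10, r0, r1, hd, hdbar]
  generalize FF A 0 0 = d at *
  generalize FF A 1 0 = p at *
  generalize FF A 0 1 = q at *
  generalize FF A 1 1 = m at *
  have dpos : 0 < d := by linarith
  have Npos : 0 < n * d - p := by linarith
  have dposQ : (0 : ℚ) < d := by exact_mod_cast dpos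
  have NposQ : (0 : ℚ) < n * d - p := by exact_mod_cast Npos
  have lpos : (0 : ℚ) < (ℓ : ℚ) + 1 := by positivity
  have hdetQ : (d : ℚ) * m - q * p = 1 := by exact_mod_cast hdet
  have key : ((2 : ℤ) : ℚ) - (((-n * q + m : ℤ) : ℚ) / ((n * d - p : ℤ) : ℚ)
      + ((d - -q : ℤ) : ℚ) / d + ((ℓ : ℤ) : ℚ) / (((ℓ : ℤ) + 1 : ℤ) : ℚ))
      = (d * (n * d - p) - (ℓ + 1)) / (d * (n * d - p) * (ℓ + 1)) := by
    push_cast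
    field_simp
    linear_combination (-(ℓ : ℚ) - 1) * hdetQ
  rw [key, div_pos_iff_of_pos_right (by positivity)]
  have : (0 : ℚ) < d * (n * d - p) - (ℓ + 1) ↔ (0 : ℤ) < d * (n * d - p) - (ℓ + 1) := by
    constructor <;> intro h <;> exact_mod_cast h
  rw [this]
  constructor <;> intro h <;> linarith
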